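/- arXiv:1211.6863 — 3 statements merged into one kernel-verified Lean document; each statement's English description precedes it below -/
import Mathlib

section
/- Let X be a second countable locally compact Hausdorff space. Suppose (μ, σ) and (μ′, σ′) are two pairs, each consisting of a finite positive Borel measure on X and a Borel function X → ℂ^m of pointwise Hermitian norm 1 almost everywhere with respect to the corresponding measure, such that ∫_X Σ_{j=1}^m conj(σ_j(x)) α_j(x) μ(dx) = ∫_X Σ_{j=1}^m conj(σ′_j(x)) α_j(x) μ′(dx) for every α ∈ C₀(X, ℂ^m). Then μ = μ′ as Borel measures and σ(x) = σ′(x) for μ-almost every x ∈ X. -/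
open MeasureTheory ENNReal ZeroAtInfty

noncomputable section

abbrev Ecm (m : ℕ) := EuclideanSpace ℂ (Fin m)

open Filter Topology

/-- A compactly supported continuous function, as a continuous function vanishing at infinity. -/
def zeroAtInftyOfHasCompactSupport {X E : Type*} [TopologicalSpace X] [TopologicalSpace E] [Zero E]
    (f : C(X, E)) (hf : HasCompactSupport f) : C₀(X, E) :=
  ⟨f, hf.is_zero_at_infty⟩

section

variable {X E : Type*} [TopologicalSpace X] [T2Space X] [LocallyCompactSpace X]
  [SecondCountableTopology X] [MeasurableSpace X] [BorelSpace X]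
  [NormedAddCommGroup E] [NormedSpace ℝ E]

/-- The indicator of a compact set is the limit of the powers of a Urysohn function, so integrals over it
are determined by integrals against compactly supported continuous functions. -/
theorem setIntegral_isCompact_eq_zero_of_forall_integral_smul_eq_zero {μ : Measure X} {f : X → E}
    (hf : Integrable f μ)
    (h : ∀ φ : C(X, ℝ), HasCompactSupport φ → ∫ x, φ x • f x ∂μ = 0)
    {K : Set X} (hK : IsCompact K) : ∫ x in K, f x ∂μ = 0 := by
  let := TopologicalSpace.metrizableSpaceMetric X
  obtain ⟨φ, hφK, -, hφc, hφ⟩ := exists_continuous_one_zero_of_isCompact_of_isGδ hK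
    hK.isClosed.isGδ isClosed_empty (Set.disjoint_empty K)
  have hlim : Tendsto (fun n : ℕ ↦ ∫ x, (φ x) ^ (n + 1) • f x ∂μ) atTop
      (𝓝 (∫ x, K.indicator f x ∂μ)) := by
    refine tendsto_integral_of_dominated_convergence (fun x ↦ ‖f x‖) (fun n ↦ ?_) hf.norm
      (fun n ↦ ae_of_all _ fun x ↦ ?_) (ae_of_all _ fun x ↦ ?_)
    · exact (φ.continuous.pow _).aestronglyMeasurable.smul hf.aestronglyMeasurable
    · rw [norm_smul, norm_pow, Real.norm_of_nonneg (hφ x).1]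
      exact mul_le_of_le_one_left (norm_nonneg _) (pow_le_one₀ (hφ x).1 (hφ x).2)
    · by_cases hx : x ∈ K
      · have hx1 : φ x = 1 := by rw [hφK] at hx; exact hx
        simp [hx, hx1]
      · have hx1 : φ x < 1 := (hφ x).2.lt_of_ne fun h1 ↦ hx (by rw [hφK]; exact h1)
        simpa [hx] using (((tendsto_pow_atTop_nhds_zero_of_lt_one (hφ x).1 hx1).comp
          (tendsto_add_atTop_nat 1)).smul_const (f x))
  have hzero (n : ℕ) : ∫ x, (φ x) ^ (n + 1) • f x ∂μ = 0 :=
    h (φ ^ (n + 1)) (hφc.mono fun x hx h0 ↦ hx (by simp [h0]))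
  simp only [hzero] at hlim
  rw [← integral_indicator hK.measurableSet]
  exact tendsto_nhds_unique hlim tendsto_const_nhds

theorem ae_eq_zero_of_forall_integral_continuous_smul_eq_zero [CompleteSpace E] {μ : Measure X}
    {f : X → E} (hf : Integrable f μ)
    (h : ∀ φ : C(X, ℝ), HasCompactSupport φ → ∫ x, φ x • f x ∂μ = 0) : f =ᵐ[μ] 0 :=
  ae_eq_zero_of_forall_setIntegral_isCompact_eq_zero hf fun _ hK ↦
    setIntegral_isCompact_eq_zero_of_forall_integral_smul_eq_zero hf h hK

/-- If the vector measures `f • μ` and `g • μ'` agree on compactly supported continuous functions,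
then their densities with respect to `μ + μ'` agree almost everywhere. -/
theorem ae_rnDeriv_smul_eq_of_forall_integral_continuous_smul_eq [CompleteSpace E]
    {μ μ' : Measure X} [IsFiniteMeasure μ] [IsFiniteMeasure μ'] {f g : X → E}
    (hf : Integrable f μ) (hg : Integrable g μ')
    (h : ∀ φ : C(X, ℝ), HasCompactSupport φ → ∫ x, φ x • f x ∂μ = ∫ x, φ x • g x ∂μ') :
    ∀ᵐ x ∂(μ + μ'), (μ.rnDeriv (μ + μ') x).toReal • f x =
      (μ'.rnDeriv (μ + μ') x).toReal • g x := by
  have hμ : μ ≪ μ + μ' := Measure.AbsolutelyContinuous.rfl.add_right μ'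
  have hμ' : μ' ≪ μ + μ' := by
    rw [add_comm]; exact Measure.AbsolutelyContinuous.rfl.add_right μ
  have hF := (integrable_rnDeriv_smul_iff hμ).2 hf
  have hG := (integrable_rnDeriv_smul_iff hμ').2 hg
  have key := ae_eq_zero_of_forall_integral_continuous_smul_eq_zero (hF.sub hG) fun φ hφ ↦ by
    obtain ⟨C, hC⟩ := hφ.exists_bound_of_continuous φ.continuous
    have hb {ν : Measure X} {k : X → E} (hk : Integrable k ν) :
        Integrable (fun x ↦ φ x • k x) ν :=
      hk.bdd_smul C φ.continuous.aestronglyMeasurable (ae_of_all _ hC)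
    simp only [Pi.sub_apply, smul_sub]
    rw [integral_sub (hb hF) (hb hG), sub_eq_zero]
    simp only [smul_comm (φ _)]
    rw [integral_rnDeriv_smul hμ, integral_rnDeriv_smul hμ', h φ hφ]
  filter_upwards [key] with x hx
  exact sub_eq_zero.1 hx

end

theorem ae_rnDeriv_ne_zero_imp {X : Type*} [MeasurableSpace X] {μ ν : Measure X} [SigmaFinite μ]
    [SigmaFinite ν] (hμν : μ ≪ ν) {p : X → Prop} (hp : ∀ᵐ x ∂μ, p x) :
    ∀ᵐ x ∂ν, μ.rnDeriv ν x ≠ 0 → p x := by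
  rw [← Measure.withDensity_rnDeriv_eq μ ν hμν] at hp
  exact (ae_withDensity_iff (Measure.measurable_rnDeriv μ ν)).1 hp

/-- uniqueness in the vector Riesz–Markoff representation: if two
pairs `(μ, σ)` and `(μ′, σ′)`, each a finite positive Borel measure together with a
Borel function of pointwise Hermitian norm one a.e., induce the same functional on
`C₀(X, ℂ^m)`, then `μ = μ′` and `σ = σ′` `μ`-almost everywhere. -/
theorem riesz_markoff_vector_unique (m : ℕ) (hm : 1 ≤ m)
    (X : Type*) [TopologicalSpace X] [T2Space X] [LocallyCompactSpace X]
    [SecondCountableTopology X] [MeasurableSpace X] [BorelSpace X]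
    (μ μ' : Measure X) (hμ : IsFiniteMeasure μ) (hμ' : IsFiniteMeasure μ')
    (σ σ' : X → Ecm m) (hσ : ∀ j, Measurable fun x => σ x j) (hσ' : ∀ j, Measurable fun x => σ' x j)
    (hσ1 : ∀ᵐ x ∂μ, ‖σ x‖ = 1) (hσ'1 : ∀ᵐ x ∂μ', ‖σ' x‖ = 1)
    (heq : ∀ α : C₀(X, Ecm m),
      ∫ x, ∑ j, (starRingEnd ℂ) (σ x j) * α x j ∂μ =
      ∫ x, ∑ j, (starRingEnd ℂ) (σ' x j) * α x j ∂μ') :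
    μ = μ' ∧ ∀ᵐ x ∂μ, σ x = σ' x := by
  have hint {ν : Measure X} [IsFiniteMeasure ν] {τ : X → Ecm m}
      (hτ : ∀ j, Measurable fun x => τ x j) (hτ1 : ∀ᵐ x ∂ν, ‖τ x‖ = 1) (j : Fin m) :
      Integrable (fun x ↦ (starRingEnd ℂ) (τ x j)) ν := by
    refine Integrable.of_bound
      (Complex.continuous_conj.measurable.comp (hτ j)).aestronglyMeasurable 1 ?_
    filter_upwards [hτ1] with x hx
    rw [RCLike.norm_conj, ← hx]
    exact PiLp.norm_apply_le (τ x) j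
  have hcoord (j : Fin m) := ae_rnDeriv_smul_eq_of_forall_integral_continuous_smul_eq
    (hint hσ hσ1 j) (hint hσ' hσ'1 j) fun φ hφ ↦ by
      have hψ : HasCompactSupport fun x ↦ EuclideanSpace.single j ((φ x : ℝ) : ℂ) :=
        hφ.mono fun x hx h0 ↦ hx (by simp [h0])
      have hc : Continuous fun x ↦ EuclideanSpace.single j ((φ x : ℝ) : ℂ) := by
        have : Continuous fun x ↦ (φ x) • EuclideanSpace.single j (1 : ℂ) := by fun_prop
        convert this using 2 with x
        ext i
        by_cases hi : i = j <;> simp [hi]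
      have := heq (zeroAtInftyOfHasCompactSupport ⟨_, hc⟩ hψ)
      simpa [zeroAtInftyOfHasCompactSupport, mul_comm] using this
  have hac : μ ≪ μ + μ' := Measure.AbsolutelyContinuous.rfl.add_right μ'
  have hac' : μ' ≪ μ + μ' := by
    rw [add_comm]; exact Measure.AbsolutelyContinuous.rfl.add_right μ
  have hvec : ∀ᵐ x ∂(μ + μ'), (μ.rnDeriv (μ + μ') x).toReal • σ x =
      (μ'.rnDeriv (μ + μ') x).toReal • σ' x := by
    filter_upwards [ae_all_iff.2 hcoord] with x hx
    ext j
    simpa using congrArg (starRingEnd ℂ) (hx j)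
  have hdens : μ.rnDeriv (μ + μ') =ᵐ[μ + μ'] μ'.rnDeriv (μ + μ') := by
    filter_upwards [hvec, ae_rnDeriv_ne_zero_imp hac hσ1, ae_rnDeriv_ne_zero_imp hac' hσ'1,
      μ.rnDeriv_ne_top (μ + μ'), μ'.rnDeriv_ne_top (μ + μ')] with x hx h1 h1' ht ht'
    rw [← ENNReal.toReal_eq_toReal_iff' ht ht']
    have hnorm {a : ℝ≥0∞} {v : Ecm m} (ha : a ≠ 0 → ‖v‖ = 1) : ‖a.toReal • v‖ = a.toReal := by
      rcases eq_or_ne a 0 with rfl | h0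
      · simp
      · simp [norm_smul, ha h0]
    rw [← hnorm h1, ← hnorm h1', hx]
  refine ⟨?_, ?_⟩
  · rw [← Measure.withDensity_rnDeriv_eq μ _ hac, withDensity_congr_ae hdens,
      Measure.withDensity_rnDeriv_eq μ' _ hac']
  · filter_upwards [hac.ae_le hvec, hac.ae_le hdens, Measure.rnDeriv_pos hac,
      hac.ae_le (μ.rnDeriv_ne_top (μ + μ'))] with x hx hd hpos ht
    rw [← hd] at hx
    exact smul_right_injective _ (ENNReal.toReal_pos hpos.ne' ht).ne' hx
end
end

section
/- Let m ≥ 1 and let p satisfy p ≥ 1 if m = 1 and p > m/2 if m ≥ 2. If w : ℝ^m → ℂ is Borel and uniformly locally p-integrable, i.e. sup_{x∈ℝ^m} ∫_{B_1(x)} |w(y)|^p dy < ∞ where B_1(x) is the open unit ball centered at x, then w belongs to the Kato class K(ℝ^m). -/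
open MeasureTheory Filter ENNReal

noncomputable section

abbrev Em (m : ℕ) := EuclideanSpace ℝ (Fin m)

/-- The heat kernel `p(t,x,y) = (2πt)^{-m/2} exp(-|x-y|²/(2t))` of `Δ/2` on `ℝ^m`. -/
def heatk (m : ℕ) (t : ℝ) (x y : Em m) : ℝ :=
  (2 * Real.pi * t) ^ (-(m : ℝ) / 2) * Real.exp (-‖x - y‖ ^ 2 / (2 * t))

/-- The Kato class `K(ℝ^m)`: Borel functions `w` with
`lim_{t→0+} sup_x ∫_0^t ∫ p(s,x,y) |w(y)| dy ds = 0`. -/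
def InKatoClass (m : ℕ) (w : Em m → ℂ) : Prop :=
  Tendsto
    (fun t : ℝ => ⨆ x : Em m,
      ∫⁻ s in Set.Ioc (0 : ℝ) t,
        ∫⁻ y, ENNReal.ofReal (heatk m s x y) * (‖w y‖₊ : ℝ≥0∞) ∂volume ∂volume)
    (nhdsWithin 0 (Set.Ioi 0)) (nhds 0)

lemma lintegral_exp_neg_mul_sq_norm_sub (m : ℕ) {b : ℝ} (hb : 0 < b) (x : Em m) :
    ∫⁻ y : Em m, ENNReal.ofReal (Real.exp (-b * ‖x - y‖ ^ 2)) =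
      ENNReal.ofReal ((Real.pi / b) ^ ((m : ℝ) / 2)) := by
  have hI := GaussianFourier.integral_rexp_neg_mul_sq_norm (V := Em m) hb
  rw [finrank_euclideanSpace_fin] at hI
  have hint : Integrable (fun v : Em m ↦ Real.exp (-b * ‖v‖ ^ 2)) := by
    by_contra h
    rw [integral_undef h] at hI
    have : 0 < (Real.pi / b) ^ ((m : ℝ) / 2) := by positivity
    exact this.ne hI
  rw [lintegral_sub_left_eq_self (fun y : Em m ↦ ENNReal.ofReal (Real.exp (-b * ‖y‖ ^ 2))) x,
    ← hI, ofReal_integral_eq_lintegral_ofReal hint (ae_of_all _ fun _ ↦ (Real.exp_pos _).le)]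

/-- Gaussian averages of `f` are controlled by the integrals of `f` over unit balls. -/
lemma volume_ball_mul_lintegral_exp_mul_le (m : ℕ) {f : Em m → ℝ≥0∞} (hf : Measurable f)
    (x : Em m) :
    volume (Metric.ball (0 : Em m) 1) *
        ∫⁻ y, ENNReal.ofReal (Real.exp (-(1 / 2) * ‖x - y‖ ^ 2)) * f y ≤
      ENNReal.ofReal (Real.exp (1 / 2)) * ENNReal.ofReal ((Real.pi / (1 / 4)) ^ ((m : ℝ) / 2)) *
        ⨆ z : Em m, ∫⁻ y in Metric.ball z 1, f y := by
  set g : Em m → ℝ≥0∞ := fun y ↦ ENNReal.ofReal (Real.exp (-(1 / 2) * ‖x - y‖ ^ 2)) * f y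
    with hg_def
  have hg : Measurable g := by fun_prop
  set K := ⨆ z : Em m, ∫⁻ y in Metric.ball z 1, f y
  have hmeas : Measurable (Function.uncurry fun y z : Em m ↦
      (Metric.ball y 1).indicator (fun _ ↦ g y) z) := by
    have : (Function.uncurry fun y z : Em m ↦ (Metric.ball y 1).indicator (fun _ ↦ g y) z) =
        {q : Em m × Em m | dist q.2 q.1 < 1}.indicator (fun q ↦ g q.1) := by
      ext q
      simp [Function.uncurry, Set.indicator, Metric.mem_ball]
    rw [this]
    exact (hg.comp measurable_fst).indicator
      (measurableSet_lt (measurable_snd.dist measurable_fst) measurable_const)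
  calc volume (Metric.ball (0 : Em m) 1) * ∫⁻ y, g y
      = ∫⁻ y, ∫⁻ z, (Metric.ball y 1).indicator (fun _ ↦ g y) z := by
        rw [← lintegral_const_mul _ hg]
        refine lintegral_congr fun y ↦ ?_
        rw [lintegral_indicator_const Metric.isOpen_ball.measurableSet,
          Measure.addHaar_ball_center volume y, mul_comm]
    _ = ∫⁻ z, ∫⁻ y, (Metric.ball y 1).indicator (fun _ ↦ g y) z :=
        lintegral_lintegral_swap hmeas.aemeasurable
    _ ≤ ∫⁻ z, ENNReal.ofReal (Real.exp (1 / 2)) *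
          ENNReal.ofReal (Real.exp (-(1 / 4) * ‖x - z‖ ^ 2)) * K := by
        refine lintegral_mono fun z ↦ ?_
        have hz : ∀ y, (Metric.ball y 1).indicator (fun _ ↦ g y) z ≤
            (Metric.ball z 1).indicator (fun y ↦ ENNReal.ofReal (Real.exp (1 / 2)) *
              ENNReal.ofReal (Real.exp (-(1 / 4) * ‖x - z‖ ^ 2)) * f y) y := by
          intro y
          by_cases h : dist z y < 1
          · rw [Set.indicator_of_mem (Metric.mem_ball.2 h),
              Set.indicator_of_mem (Metric.mem_ball'.2 h), hg_def,
              ← ENNReal.ofReal_mul (Real.exp_pos _).le, ← Real.exp_add]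
            dsimp only
            gcongr
            have h1 : ‖x - z‖ ≤ ‖x - y‖ + 1 := by
              have := dist_triangle x y z
              rw [dist_comm y z, dist_eq_norm, dist_eq_norm x y] at this
              linarith
            nlinarith [sq_nonneg (‖x - y‖ - 1), norm_nonneg (x - z), norm_nonneg (x - y)]
          · rw [Set.indicator_of_notMem (fun h' ↦ h (Metric.mem_ball.1 h'))]
            exact zero_le
        refine (lintegral_mono hz).trans ?_
        rw [lintegral_indicator Metric.isOpen_ball.measurableSet, lintegral_const_mul _ hf]
        gcongr
        exact le_iSup (fun z : Em m ↦ ∫⁻ y in Metric.ball z 1, f y) z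
    _ = _ := by
        rw [lintegral_mul_const _ (by fun_prop), lintegral_const_mul _ (by fun_prop),
          lintegral_exp_neg_mul_sq_norm_sub m (by norm_num)]

lemma measurable_ofReal_heatk (m : ℕ) (s : ℝ) (x : Em m) :
    Measurable fun y ↦ ENNReal.ofReal (heatk m s x y) := by
  unfold heatk
  fun_prop

lemma lintegral_heatk (m : ℕ) {s : ℝ} (hs : 0 < s) (x : Em m) :
    ∫⁻ y, ENNReal.ofReal (heatk m s x y) = 1 := by
  have h : ∀ y, ENNReal.ofReal (heatk m s x y) =
      ENNReal.ofReal ((2 * Real.pi * s) ^ (-(m : ℝ) / 2)) *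
        ENNReal.ofReal (Real.exp (-(1 / (2 * s)) * ‖x - y‖ ^ 2)) := by
    intro y
    rw [heatk, ENNReal.ofReal_mul (by positivity)]
    congr 3
    ring
  simp_rw [h]
  rw [lintegral_const_mul _ (by fun_prop), lintegral_exp_neg_mul_sq_norm_sub m (by positivity),
    ← ENNReal.ofReal_mul (by positivity)]
  have : Real.pi / (1 / (2 * s)) = 2 * Real.pi * s := by field_simp
  rw [this, ← Real.rpow_add (by positivity)]
  simp [neg_div]

/-- Jensen's inequality for the heat kernel. -/
lemma lintegral_heatk_mul_le_rpow (m : ℕ) {s p : ℝ} (hs : 0 < s) (hp : 1 ≤ p)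
    {w : Em m → ℂ} (hw : Measurable w) (x : Em m) :
    ∫⁻ y, ENNReal.ofReal (heatk m s x y) * (‖w y‖₊ : ℝ≥0∞) ≤
      (∫⁻ y, ENNReal.ofReal (heatk m s x y) * (‖w y‖₊ : ℝ≥0∞) ^ p) ^ (1 / p) := by
  have hk := measurable_ofReal_heatk m s x
  let μ : Measure (Em m) := volume.withDensity fun y ↦ ENNReal.ofReal (heatk m s x y)
  have : IsProbabilityMeasure μ := ⟨by
    rw [withDensity_apply _ MeasurableSet.univ, Measure.restrict_univ, lintegral_heatk m hs x]⟩
  have h := eLpNorm'_le_eLpNorm'_of_exponent_le one_pos hp μ hw.aestronglyMeasurable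
  simp only [eLpNorm', enorm_eq_nnnorm, ENNReal.rpow_one, div_one] at h
  rwa [lintegral_withDensity_eq_lintegral_mul _ hk (by fun_prop),
    lintegral_withDensity_eq_lintegral_mul _ hk (by fun_prop)] at h

lemma heatk_le (m : ℕ) {s : ℝ} (hs : 0 < s) (hs1 : s ≤ 1) (x y : Em m) :
    heatk m s x y ≤ s ^ (-(m : ℝ) / 2) * Real.exp (-(1 / 2) * ‖x - y‖ ^ 2) := by
  unfold heatk
  have h1 : (2 * Real.pi * s) ^ (-(m : ℝ) / 2) ≤ s ^ (-(m : ℝ) / 2) := by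
    apply Real.rpow_le_rpow_of_nonpos hs
    · nlinarith [Real.pi_gt_three]
    · have : (0 : ℝ) ≤ m := m.cast_nonneg
      linarith
  gcongr
  rw [div_le_iff₀ (by positivity)]
  nlinarith [sq_nonneg ‖x - y‖]

/-- The heat semigroup maps uniformly locally `L^p` functions to bounded functions, with norm
`O(s ^ (-m / (2 * p)))` for small times `s`. -/
lemma exists_lintegral_heatk_mul_le (m : ℕ) {p : ℝ} (hp : 1 ≤ p) {w : Em m → ℂ}
    (hw : Measurable w)
    (hloc : (⨆ x : Em m, ∫⁻ y in Metric.ball x 1, (‖w y‖₊ : ℝ≥0∞) ^ p ∂volume) ≠ ⊤) :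
    ∃ C : ℝ≥0∞, C ≠ ⊤ ∧ ∀ (x : Em m) (s : ℝ), 0 < s → s ≤ 1 →
      ∫⁻ y, ENNReal.ofReal (heatk m s x y) * (‖w y‖₊ : ℝ≥0∞) ≤
        C * ENNReal.ofReal (s ^ (-(m : ℝ) / 2 * (1 / p))) := by
  have hp0 : 0 < p := by linarith
  set K := ⨆ x : Em m, ∫⁻ y in Metric.ball x 1, (‖w y‖₊ : ℝ≥0∞) ^ p
  set V := volume (Metric.ball (0 : Em m) 1)
  have hV0 : V ≠ 0 := (Metric.measure_ball_pos _ _ one_pos).ne'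
  have hVt : V ≠ ⊤ := measure_ball_lt_top.ne
  set A := ENNReal.ofReal (Real.exp (1 / 2)) *
    ENNReal.ofReal ((Real.pi / (1 / 4)) ^ ((m : ℝ) / 2)) * K
  have hAt : A ≠ ⊤ := by finiteness
  have hf : Measurable fun y ↦ (‖w y‖₊ : ℝ≥0∞) ^ p := by fun_prop
  refine ⟨(A / V) ^ (1 / p), ENNReal.rpow_ne_top_of_nonneg (by positivity)
    (ENNReal.div_ne_top hAt hV0), fun x s hs hs1 ↦ ?_⟩
  have hball : ∫⁻ y, ENNReal.ofReal (Real.exp (-(1 / 2) * ‖x - y‖ ^ 2)) *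
      (‖w y‖₊ : ℝ≥0∞) ^ p ≤ A / V := by
    rw [ENNReal.le_div_iff_mul_le (Or.inl hV0) (Or.inl hVt), mul_comm]
    exact volume_ball_mul_lintegral_exp_mul_le m hf x
  calc ∫⁻ y, ENNReal.ofReal (heatk m s x y) * (‖w y‖₊ : ℝ≥0∞)
      ≤ (∫⁻ y, ENNReal.ofReal (heatk m s x y) * (‖w y‖₊ : ℝ≥0∞) ^ p) ^ (1 / p) :=
        lintegral_heatk_mul_le_rpow m hs hp hw x
    _ ≤ (∫⁻ y, ENNReal.ofReal (s ^ (-(m : ℝ) / 2)) *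
          (ENNReal.ofReal (Real.exp (-(1 / 2) * ‖x - y‖ ^ 2)) *
            (‖w y‖₊ : ℝ≥0∞) ^ p)) ^ (1 / p) := by
        refine ENNReal.rpow_le_rpow (lintegral_mono fun y ↦ ?_) (by positivity)
        dsimp only
        rw [← mul_assoc, ← ENNReal.ofReal_mul (by positivity)]
        gcongr
        exact heatk_le m hs hs1 x y
    _ ≤ (ENNReal.ofReal (s ^ (-(m : ℝ) / 2)) * (A / V)) ^ (1 / p) := by
        rw [lintegral_const_mul _ (by fun_prop)]
        gcongr
    _ = _ := by
        rw [ENNReal.mul_rpow_of_nonneg _ _ (by positivity),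
          ENNReal.ofReal_rpow_of_nonneg (by positivity) (by positivity),
          ← Real.rpow_mul hs.le, mul_comm]

lemma tendsto_setLIntegral_Ioc_rpow {r : ℝ} (hr : -1 < r) :
    Tendsto (fun t : ℝ ↦ ∫⁻ s in Set.Ioc 0 t, ENNReal.ofReal (s ^ r))
      (nhdsWithin 0 (Set.Ioi 0)) (nhds 0) := by
  have hint : IntegrableOn (fun s : ℝ ↦ s ^ r) (Set.Ioc 0 1) :=
    (intervalIntegrable_iff_integrableOn_Ioc_of_le zero_le_one).1
      (intervalIntegral.intervalIntegrable_rpow' hr)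
  have hvol : Tendsto ((volume.restrict (Set.Ioc (0 : ℝ) 1)) ∘ fun t : ℝ ↦ Set.Ioc 0 t)
      (nhdsWithin 0 (Set.Ioi 0)) (nhds 0) := by
    have h : Tendsto (fun t : ℝ ↦ ENNReal.ofReal t) (nhdsWithin 0 (Set.Ioi 0)) (nhds 0) := by
      have := (ENNReal.continuous_ofReal.tendsto 0).mono_left
        (nhdsWithin_le_nhds (s := Set.Ioi (0 : ℝ)))
      rwa [ENNReal.ofReal_zero] at this
    refine tendsto_of_tendsto_of_tendsto_of_le_of_le tendsto_const_nhds h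
      (fun _ ↦ zero_le) fun t ↦ ?_
    refine (Measure.restrict_apply_le _ _).trans ?_
    simp
  refine (tendsto_setLIntegral_zero hint.lintegral_lt_top.ne hvol).congr' ?_
  filter_upwards [Ioc_mem_nhdsGT (zero_lt_one (α := ℝ))] with t ht
  rw [Measure.restrict_restrict measurableSet_Ioc,
    Set.inter_eq_left.2 (Set.Ioc_subset_Ioc_right ht.2)]


/-- with `p ≥ 1` if `m = 1` and `p > m/2` if `m ≥ 2`, every uniformly
locally `p`-integrable Borel function on `ℝ^m` (i.e.
`sup_x ∫_{B_1(x)} |w|^p < ∞`) belongs to the Kato class `K(ℝ^m)`. -/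
theorem uniformly_locally_Lp_subset_kato (m : ℕ) (hm : 1 ≤ m) (p : ℝ)
    (hp1 : m = 1 → 1 ≤ p) (hp2 : 2 ≤ m → (m : ℝ) / 2 < p)
    (w : Em m → ℂ) (hw : Measurable w)
    (hloc : (⨆ x : Em m, ∫⁻ y in Metric.ball x 1, (‖w y‖₊ : ℝ≥0∞) ^ p ∂volume) ≠ ⊤) :
    InKatoClass m w := by
  have hpm : 1 ≤ p ∧ (m : ℝ) / 2 < p := by
    rcases hm.eq_or_lt with h | h
    · have := hp1 h.symm
      rw [← h]
      constructor <;> norm_num <;> linarith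
    · have h2 : (2 : ℝ) ≤ m := by exact_mod_cast h
      have := hp2 h
      constructor <;> linarith
  obtain ⟨hp, hmp⟩ := hpm
  obtain ⟨C, hC, hbound⟩ := exists_lintegral_heatk_mul_le m hp hw hloc
  have hr : -1 < -(m : ℝ) / 2 * (1 / p) := by
    rw [mul_one_div, lt_div_iff₀ (by linarith)]
    linarith
  have hlim := ENNReal.Tendsto.const_mul (tendsto_setLIntegral_Ioc_rpow hr) (Or.inr hC)
  rw [mul_zero] at hlim
  refine tendsto_of_tendsto_of_tendsto_of_le_of_le' tendsto_const_nhds hlim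
    (Eventually.of_forall fun _ ↦ zero_le) ?_
  filter_upwards [Ioc_mem_nhdsGT (zero_lt_one (α := ℝ))] with t ht
  refine iSup_le fun x ↦ ?_
  rw [← lintegral_const_mul _ (by fun_prop)]
  exact setLIntegral_mono (by fun_prop) fun s hs ↦ hbound x s hs.1 (hs.2.trans ht.2)
end
end

section
/- (Kas'minskii's lemma, analytic form on ℝ^m.) Let w : ℝ^m → ℂ be Borel, let s > 0, and for n ≥ 1 and x ∈ ℝ^m set a_n(x,s) := ∫_{0 ≤ q_1 ≤ … ≤ q_n ≤ s} ∫_{(ℝ^m)^n} Π_{i=1}^n [ p(q_i − q_{i−1}, x_{i−1}, x_i) |w(x_i)| ] dx_1 … dx_n dq_1 … dq_n, with q_0 := 0, x_0 := x, and a_0(x,s) := 1. If D := sup_{x∈ℝ^m} a_1(x,s) < 1, then sup_{x∈ℝ^m} Σ_{n=0}^∞ a_n(x,s) ≤ 1/(1 − D). -/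
open MeasureTheory Filter ENNReal

noncomputable section

/-- The iterated time-ordered integrals
`a_n(x,s) = ∫_{0 ≤ q_1 ≤ … ≤ q_n ≤ s} ∫_{(ℝ^m)^n} Π_i p(q_i − q_{i−1}, x_{i−1}, x_i) |w(x_i)| dx dq`,
with `q_0 = 0`, `x_0 = x`, and `a_0(x,s) = 1`. -/
def aFK (m : ℕ) (w : Em m → ℂ) : ℕ → Em m → ℝ → ℝ≥0∞
  | 0, _, _ => 1
  | n + 1, x, s =>
    ∫⁻ q : Fin (n + 1) → ℝ in
        {q | (∀ i j : Fin (n + 1), i ≤ j → q i ≤ q j) ∧ 0 ≤ q 0 ∧ q (Fin.last n) ≤ s},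
      ∫⁻ xs : Fin (n + 1) → Em m,
        ∏ i : Fin (n + 1),
          ENNReal.ofReal
              (heatk m (q i - if i = 0 then 0 else q (i - 1))
                (if i = 0 then x else xs (i - 1)) (xs i)) *
            (‖w (xs i)‖₊ : ℝ≥0∞)

/-- One factor `p(r,x,y) |w(y)|` of the integrand of `aFK`. -/
def kernelFK (m : ℕ) (w : Em m → ℂ) (r : ℝ) (x y : Em m) : ℝ≥0∞ :=
  ENNReal.ofReal (heatk m r x y) * (‖w y‖₊ : ℝ≥0∞)

/-- The integrand of `aFK`. -/
def integrandFK (m n : ℕ) (w : Em m → ℂ) (x : Em m) (q : Fin (n + 1) → ℝ)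
    (xs : Fin (n + 1) → Em m) : ℝ≥0∞ :=
  ∏ i : Fin (n + 1),
    kernelFK m w (q i - if i = 0 then 0 else q (i - 1)) (if i = 0 then x else xs (i - 1)) (xs i)

/-- The set of ordered time vectors `0 ≤ q_1 ≤ … ≤ q_{n+1} ≤ s`. -/
def orderedTimes (n : ℕ) (s : ℝ) : Set (Fin (n + 1) → ℝ) :=
  {q | (∀ i j : Fin (n + 1), i ≤ j → q i ≤ q j) ∧ 0 ≤ q 0 ∧ q (Fin.last n) ≤ s}

theorem aFK_succ (m n : ℕ) (w : Em m → ℂ) (x : Em m) (s : ℝ) :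
    aFK m w (n + 1) x s = ∫⁻ q in orderedTimes n s, ∫⁻ xs, integrandFK m n w x q xs :=
  rfl

theorem measurable_kernelFK {m : ℕ} {w : Em m → ℂ} (hw : Measurable w) {α : Type*}
    [MeasurableSpace α] {r : α → ℝ} {x y : α → Em m} (hr : Measurable r) (hx : Measurable x)
    (hy : Measurable y) : Measurable fun a => kernelFK m w (r a) (x a) (y a) := by
  unfold kernelFK heatk
  fun_prop

theorem measurable_integrandFK {m n : ℕ} {w : Em m → ℂ} (hw : Measurable w) (x : Em m)
    {α : Type*} [MeasurableSpace α] {q : α → Fin (n + 1) → ℝ} {xs : α → Fin (n + 1) → Em m}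
    (hq : Measurable q) (hxs : Measurable xs) :
    Measurable fun a => integrandFK m n w x (q a) (xs a) := by
  unfold integrandFK
  refine Finset.measurable_prod _ fun i _ => measurable_kernelFK hw ?_ ?_ (by fun_prop)
  all_goals split_ifs <;> fun_prop

theorem measurableSet_orderedTimes (n : ℕ) (s : ℝ) : MeasurableSet (orderedTimes n s) := by
  have h : IsClosed (orderedTimes n s) := by
    simp only [orderedTimes, Set.ofPred_and, Set.ofPred_forall]
    refine IsClosed.inter ?_ (IsClosed.inter ?_ ?_)
    · exact isClosed_iInter fun i => isClosed_iInter fun j => isClosed_iInter fun _ =>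
        isClosed_le (by fun_prop) (by fun_prop)
    · exact isClosed_le (by fun_prop) (by fun_prop)
    · exact isClosed_le (by fun_prop) (by fun_prop)
  exact h.measurableSet

theorem lintegral_finSnoc {α : Type*} [MeasureSpace α] [SigmaFinite (volume : Measure α)]
    (n : ℕ) {f : (Fin (n + 1) → α) → ℝ≥0∞} (hf : Measurable f) :
    ∫⁻ z, f z = ∫⁻ z : Fin n → α, ∫⁻ r : α, f (Fin.snoc z r) := by
  have e := (volume_preserving_piFinSuccAbove (fun _ : Fin (n + 1) => α) (Fin.last n)).symm
  rw [← e.lintegral_comp hf]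
  rw [Measure.volume_eq_prod, lintegral_prod_symm (fun z => f ((MeasurableEquiv.piFinSuccAbove _ _).symm z))
      (hf.comp e.measurable).aemeasurable]
  refine lintegral_congr fun z => lintegral_congr fun r => ?_
  congr 1
  simp [MeasurableEquiv.piFinSuccAbove, Fin.insertNthEquiv, Fin.insertNth_last']

theorem aFK_one {m : ℕ} (w : Em m → ℂ) (x : Em m) (s : ℝ) :
    aFK m w 1 x s = ∫⁻ r in Set.Icc 0 s, ∫⁻ y, kernelFK m w r x y := by
  have e := volume_preserving_funUnique (Fin 1) ℝ
  have e' := volume_preserving_funUnique (Fin 1) (Em m)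
  have hS : orderedTimes 0 s = MeasurableEquiv.funUnique (Fin 1) ℝ ⁻¹' Set.Icc 0 s := by
    ext q
    simp [orderedTimes, MeasurableEquiv.funUnique]
  rw [show (1 : ℕ) = 0 + 1 from rfl, aFK_succ, hS,
    ← e.setLIntegral_comp_preimage_emb (MeasurableEquiv.measurableEmbedding _)]
  refine lintegral_congr fun q => ?_
  rw [← e'.lintegral_comp_emb (MeasurableEquiv.measurableEmbedding _)]
  refine lintegral_congr fun y => ?_
  simp [integrandFK, MeasurableEquiv.funUnique]

theorem integrandFK_snoc {m n : ℕ} (w : Em m → ℂ) (x : Em m) (q : Fin (n + 1) → ℝ) (r : ℝ)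
    (xs : Fin (n + 1) → Em m) (y : Em m) :
    integrandFK m (n + 1) w x (Fin.snoc q r) (Fin.snoc xs y) =
      integrandFK m n w x q xs * kernelFK m w (r - q (Fin.last n)) (xs (Fin.last n)) y := by
  have hlast : Fin.last (n + 1) - 1 = (Fin.last n).castSucc := by
    ext
    rw [Fin.val_sub_one_of_ne_zero Fin.last_pos.ne']
    simp
  have hsub (i : Fin (n + 1)) (hi : i ≠ 0) : i.castSucc - 1 = (i - 1).castSucc := by
    ext
    simp only [Fin.val_castSucc]
    rw [Fin.val_sub_one_of_ne_zero hi, Fin.val_sub_one_of_ne_zero (by simpa using hi)]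
    simp
  unfold integrandFK
  rw [Fin.prod_univ_castSucc]
  congr 1
  · refine Finset.prod_congr rfl fun i _ => ?_
    by_cases hi : i = 0
    · simp only [hi, if_true, ← Fin.castSucc_zero, Fin.snoc_castSucc]
    · have hi' : i.castSucc ≠ 0 := by simpa using hi
      simp only [if_neg hi, if_neg hi', hsub i hi, Fin.snoc_castSucc]
  · have h0 : Fin.last (n + 1) ≠ 0 := Fin.last_pos.ne'
    simp only [if_neg h0, hlast, Fin.snoc_castSucc, Fin.snoc_last]

theorem mem_orderedTimes_of_snoc {n : ℕ} {s : ℝ} {q : Fin (n + 1) → ℝ} {r : ℝ}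
    (h : (Fin.snoc q r : Fin (n + 2) → ℝ) ∈ orderedTimes (n + 1) s) :
    q ∈ orderedTimes n s ∧ r ∈ Set.Icc (q (Fin.last n)) s := by
  obtain ⟨hmono, h0, hs⟩ := h
  have hr : q (Fin.last n) ≤ r := by
    simpa only [Fin.snoc_castSucc, Fin.snoc_last] using
      hmono (Fin.last n).castSucc (Fin.last (n + 1)) (Fin.le_last _)
  rw [Fin.snoc_last] at hs
  rw [← Fin.castSucc_zero, Fin.snoc_castSucc] at h0
  refine ⟨⟨fun i j hij => ?_, h0, hr.trans hs⟩, hr, hs⟩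
  simpa only [Fin.snoc_castSucc] using hmono i.castSucc j.castSucc (by simpa using hij)

theorem setLIntegral_kernelFK_le {m : ℕ} (w : Em m → ℂ) (x : Em m) {s t : ℝ} (ht : 0 ≤ t) :
    ∫⁻ r in Set.Icc t s, ∫⁻ y, kernelFK m w (r - t) x y ≤ ⨆ z : Em m, aFK m w 1 z s := by
  have e : MeasurePreserving (fun r : ℝ => r - t) := measurePreserving_sub_right volume t
  calc ∫⁻ r in Set.Icc t s, ∫⁻ y, kernelFK m w (r - t) x y
      ≤ ∫⁻ r in (fun r : ℝ => r - t) ⁻¹' Set.Icc 0 s, ∫⁻ y, kernelFK m w (r - t) x y := by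
        refine lintegral_mono_set fun r hr => ?_
        exact ⟨sub_nonneg.2 hr.1, by linarith [hr.2]⟩
    _ = aFK m w 1 x s := by
        rw [aFK_one]
        exact e.setLIntegral_comp_preimage_emb (MeasurableEquiv.subRight t).measurableEmbedding
          (fun r => ∫⁻ y, kernelFK m w r x y) _
    _ ≤ _ := le_iSup (fun z => aFK m w 1 z s) x

theorem aFK_succ_succ_le {m : ℕ} {w : Em m → ℂ} (hw : Measurable w) (n : ℕ) (x : Em m) (s : ℝ) :
    aFK m w (n + 2) x s ≤ aFK m w (n + 1) x s * ⨆ z : Em m, aFK m w 1 z s := by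
  have hmeas : Measurable fun q : Fin (n + 2) → ℝ => ∫⁻ xs, integrandFK m (n + 1) w x q xs :=
    Measurable.lintegral_prod_right'
      (f := fun z : (Fin (n + 2) → ℝ) × (Fin (n + 2) → Em m) => integrandFK m (n + 1) w x z.1 z.2)
      (measurable_integrandFK hw x measurable_fst measurable_snd)
  have hker (q : Fin (n + 1) → ℝ) : Measurable fun z : (ℝ × (Fin (n + 1) → Em m)) × Em m =>
      kernelFK m w (z.1.1 - q (Fin.last n)) (z.1.2 (Fin.last n)) z.2 :=
    measurable_kernelFK hw (by fun_prop) (by fun_prop) (by fun_prop)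
  rw [aFK_succ, aFK_succ, ← lintegral_indicator (measurableSet_orderedTimes _ _),
    lintegral_finSnoc _ (hmeas.indicator (measurableSet_orderedTimes _ _)),
    ← lintegral_mul_const _ (Measurable.lintegral_prod_right'
      (f := fun z : (Fin (n + 1) → ℝ) × (Fin (n + 1) → Em m) => integrandFK m n w x z.1 z.2)
      (measurable_integrandFK hw x measurable_fst measurable_snd)),
    ← lintegral_indicator (measurableSet_orderedTimes _ _)]
  refine lintegral_mono fun q => ?_
  by_cases hq : q ∈ orderedTimes n s
  swap
  · have h (r : ℝ) : (Fin.snoc q r : Fin (n + 2) → ℝ) ∉ orderedTimes (n + 1) s :=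
      fun hr => hq (mem_orderedTimes_of_snoc hr).1
    simp [Set.indicator_of_notMem (h _)]
  have hq0 : 0 ≤ q (Fin.last n) := hq.2.1.trans (hq.1 _ _ (Fin.zero_le _))
  have hint (r : ℝ) : ∫⁻ xs, integrandFK m (n + 1) w x (Fin.snoc q r) xs =
      ∫⁻ xs, integrandFK m n w x q xs *
        ∫⁻ y, kernelFK m w (r - q (Fin.last n)) (xs (Fin.last n)) y := by
    rw [lintegral_finSnoc _ (measurable_integrandFK hw x measurable_const measurable_id')]
    refine lintegral_congr fun xs => ?_
    simp only [integrandFK_snoc]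
    exact lintegral_const_mul _
      (measurable_kernelFK hw measurable_const measurable_const measurable_id)
  have hmeas' : Measurable fun z : ℝ × (Fin (n + 1) → Em m) => integrandFK m n w x q z.2 *
      ∫⁻ y, kernelFK m w (z.1 - q (Fin.last n)) (z.2 (Fin.last n)) y :=
    (measurable_integrandFK hw x measurable_const measurable_snd).mul (hker q).lintegral_prod_right'
  rw [Set.indicator_of_mem hq]
  dsimp only
  rw [← lintegral_mul_const _
    (measurable_integrandFK hw x measurable_const measurable_id')]
  calc _ ≤ ∫⁻ r in Set.Icc (q (Fin.last n)) s,
        ∫⁻ xs, integrandFK m (n + 1) w x (Fin.snoc q r) xs := by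
        rw [← lintegral_indicator measurableSet_Icc]
        refine lintegral_mono fun r => ?_
        by_cases hr : (Fin.snoc q r : Fin (n + 2) → ℝ) ∈ orderedTimes (n + 1) s
        · rw [Set.indicator_of_mem hr, Set.indicator_of_mem (mem_orderedTimes_of_snoc hr).2]
        · rw [Set.indicator_of_notMem hr]
          exact zero_le
    _ = ∫⁻ xs, ∫⁻ r in Set.Icc (q (Fin.last n)) s, integrandFK m n w x q xs *
        ∫⁻ y, kernelFK m w (r - q (Fin.last n)) (xs (Fin.last n)) y := by
        simp only [hint]
        exact lintegral_lintegral_swap hmeas'.aemeasurable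
    _ ≤ _ := by
        refine lintegral_mono fun xs => ?_
        have hinner : Measurable fun r : ℝ =>
            ∫⁻ y, kernelFK m w (r - q (Fin.last n)) (xs (Fin.last n)) y :=
          Measurable.lintegral_prod_right'
            (f := fun z : ℝ × Em m => kernelFK m w (z.1 - q (Fin.last n)) (xs (Fin.last n)) z.2)
            (measurable_kernelFK hw (by fun_prop) (by fun_prop) (by fun_prop))
        rw [lintegral_const_mul _ hinner]
        gcongr
        exact setLIntegral_kernelFK_le w _ hq0

theorem aFK_le_pow {m : ℕ} {w : Em m → ℂ} (hw : Measurable w) (n : ℕ) (x : Em m) (s : ℝ) :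
    aFK m w n x s ≤ (⨆ z : Em m, aFK m w 1 z s) ^ n := by
  induction n with
  | zero => simp [aFK]
  | succ n ih =>
    cases n with
    | zero => simpa using le_iSup (fun z => aFK m w 1 z s) x
    | succ n =>
      rw [pow_succ]
      exact (aFK_succ_succ_le hw n x s).trans (mul_le_mul_left ih _)

/-- Kas'minskii's lemma, analytic form on `ℝ^m`: if
`D = sup_x a_1(x,s) < 1` for some `s > 0`, then
`sup_x Σ_{n=0}^∞ a_n(x,s) ≤ 1/(1 − D)`. -/
theorem kasminskii_lemma (m : ℕ) (hm : 1 ≤ m) (w : Em m → ℂ) (hw : Measurable w)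
    (s : ℝ) (hs : 0 < s) (hD : (⨆ x : Em m, aFK m w 1 x s) < 1) :
    (⨆ x : Em m, ∑' n : ℕ, aFK m w n x s) ≤ (1 - ⨆ x : Em m, aFK m w 1 x s)⁻¹ := by
  rw [← ENNReal.tsum_geometric]
  exact iSup_le fun x => ENNReal.tsum_le_tsum fun n => aFK_le_pow hw n x s
end
end
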